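/- The functions h₀ := 4ξ₂ − 2ξ₃ − 2ξ₄, h₁ := 2ξ₃ − 2ξ₄ and η'/η satisfy the following system of differential equations at every point of ℍ: h₀' = 4·h₀·(η'/η) − (1/6)·h₀² + (1/2)·h₁²; h₁' = 4·h₁·(η'/η) + (1/3)·h₀·h₁; and (η'/η)' = 2·(η'/η)² − (1/288)·(h₀² + 3·h₁²). -/

import Mathlib

open Complex

noncomputable section

/-- `q = e^{2πiτ}`. -/
def qexp (τ : ℂ) : ℂ := Complex.exp (2 * ↑Real.pi * Complex.I * τ)

/-- `q^s = e^{2πisτ}` for real `s`. -/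
def qpow (s : ℝ) (τ : ℂ) : ℂ := Complex.exp (2 * ↑Real.pi * Complex.I * ↑s * τ)

/-- The differential operator `f' = (1/(2πi)) df/dτ` (i.e. `q d/dq`). -/
def Dq (f : ℂ → ℂ) : ℂ → ℂ := fun τ => deriv f τ / (2 * ↑Real.pi * Complex.I)

/-- The divisor power sum `σ_k(n)`. -/
def sigma' (k n : ℕ) : ℕ := ∑ d ∈ n.divisors, d ^ k

/-- The quasimodular Eisenstein series `E₂`. -/
def E2 (τ : ℂ) : ℂ := 1 - 24 * ∑' n : ℕ, (sigma' 1 (n + 1) : ℂ) * qexp τ ^ (n + 1)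

/-- The Eisenstein series `E₄`. -/
def E4 (τ : ℂ) : ℂ := 1 + 240 * ∑' n : ℕ, (sigma' 3 (n + 1) : ℂ) * qexp τ ^ (n + 1)

/-- The Eisenstein series `E₆`. -/
def E6 (τ : ℂ) : ℂ := 1 - 504 * ∑' n : ℕ, (sigma' 5 (n + 1) : ℂ) * qexp τ ^ (n + 1)

/-- The Dedekind eta function `η(τ) = q^{1/24} ∏ (1 - qⁿ)`. -/
def η (τ : ℂ) : ℂ := qpow (1/24) τ * ∏' n : ℕ, (1 - qexp τ ^ (n + 1))

/-- Theta constant `θ₂(τ) = Σ_{n∈ℤ} q^{(n-1/2)²/2}`. -/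
def θ₂ (τ : ℂ) : ℂ := ∑' n : ℤ, qpow (((n : ℝ) - 1/2) ^ 2 / 2) τ

/-- Theta constant `θ₃(τ) = Σ_{n∈ℤ} q^{n²/2}`. -/
def θ₃ (τ : ℂ) : ℂ := ∑' n : ℤ, qpow ((n : ℝ) ^ 2 / 2) τ

/-- Theta constant `θ₄(τ) = Σ_{n∈ℤ} (-1)ⁿ q^{n²/2}`. -/
def θ₄ (τ : ℂ) : ℂ := ∑' n : ℤ, (-1 : ℂ) ^ n * qpow ((n : ℝ) ^ 2 / 2) τ

/-- `ξ₂ = 2 θ₂'/θ₂`. -/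
def ξ₂ : ℂ → ℂ := fun τ => 2 * Dq θ₂ τ / θ₂ τ

/-- `ξ₃ = 2 θ₃'/θ₃`. -/
def ξ₃ : ℂ → ℂ := fun τ => 2 * Dq θ₃ τ / θ₃ τ

/-- `ξ₄ = 2 θ₄'/θ₄`. -/
def ξ₄ : ℂ → ℂ := fun τ => 2 * Dq θ₄ τ / θ₄ τ

/-- `h₀ = 4ξ₂ - 2ξ₃ - 2ξ₄` (equal to `η⁴ χ_{Λ₀}^{q}`). -/
def h₀ : ℂ → ℂ := fun τ => 4 * ξ₂ τ - 2 * ξ₃ τ - 2 * ξ₄ τ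

/-- `h₁ = 2ξ₃ - 2ξ₄` (equal to `η⁴ χ_{Λ₁}^{q}`). -/
def h₁ : ℂ → ℂ := fun τ => 2 * ξ₃ τ - 2 * ξ₄ τ

/-- The Serre-type derivative `∂_k f = f' - (k/12) E₂ f`. -/
def partialD (k : ℂ) (f : ℂ → ℂ) : ℂ → ℂ := fun τ => Dq f τ - k / 12 * E2 τ * f τ

end

open Filter Topology
open UpperHalfPlane hiding I im

/-! ### Holomorphic functions on the upper half-plane of level one -/

open ModularGroup OnePoint MatrixGroups in
lemma exists_cuspForm_levelOne {f : ℂ → ℂ} {k : ℕ}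
    (hd : DifferentiableOn ℂ f upperHalfPlaneSet)
    (hT : ∀ τ ∈ upperHalfPlaneSet, f (τ + 1) = f τ)
    (hS : ∀ τ ∈ upperHalfPlaneSet, f (-1 / τ) = τ ^ k * f τ)
    (h0 : Tendsto f (comap im atTop) (𝓝 0)) :
    ∃ F : CuspForm 𝒮ℒ k, ∀ z : ℍ, F z = f z := by
  let g : ℍ → ℂ := fun z ↦ f z
  have hgS : SlashAction.map (k : ℤ) S g = g := by
    ext z
    have hz : (z : ℂ) ≠ 0 := z.ne_zero
    have h := hS z z.2
    rw [ModularForm.SL_slash_apply, UpperHalfPlane.modular_S_smul]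
    have : g (UpperHalfPlane.mk (-(z : ℂ))⁻¹ z.im_inv_neg_coe_pos) = (z : ℂ) ^ k * f z := by
      rw [← h]
      change f (-(z : ℂ))⁻¹ = _
      congr 1
      rw [neg_div, one_div, inv_neg]
    rw [this]
    rw [show denom _ (z : ℂ) = z from denom_S z, zpow_neg, zpow_natCast]
    field_simp
    rfl
  have hgT : SlashAction.map (k : ℤ) T g = g := by
    ext z
    have h := hT z z.2
    rw [ModularForm.SL_slash_apply, UpperHalfPlane.modular_T_smul]
    have : g ((1 : ℝ) +ᵥ z) = f z := by
      rw [← h, add_comm]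
      change f ((1 : ℝ) + (z : ℂ)) = _
      simp
    rw [this]
    have hden : denom (T : GL (Fin 2) ℝ) (z : ℂ) = 1 := by
      simp [denom, ModularGroup.coe_T]
    rw [show denom _ (z : ℂ) = 1 from hden, one_zpow, mul_one]
  have hg (γ : SL(2, ℤ)) : SlashAction.map (k : ℤ) γ g = g :=
    SlashInvariantForm.slash_action_generators_SL2Z hgS hgT γ
  refine ⟨{ toFun := g, slash_action_eq' := ?_, holo' := ?_, zero_at_cusps' := ?_ }, fun z ↦ rfl⟩
  · rintro A ⟨A, rfl⟩
    exact hg A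
  · rw [UpperHalfPlane.mdifferentiable_iff]
    refine hd.congr fun z hz ↦ ?_
    simp [g, ofComplex_apply_of_im_pos hz]
  · intro c hc
    rw [Subgroup.IsArithmetic.isCusp_iff_isCusp_SL2Z] at hc
    rw [OnePoint.isZeroAt_iff_forall_SL2Z hc]
    intro γ _
    rw [hg]
    refine h0.comp ?_
    exact tendsto_comap_iff.mpr tendsto_comap

open MatrixGroups in
lemma exists_eq_const_mul_eta_pow {f : ℂ → ℂ}
    (hd : DifferentiableOn ℂ f upperHalfPlaneSet)
    (hT : ∀ τ ∈ upperHalfPlaneSet, f (τ + 1) = f τ)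
    (hS : ∀ τ ∈ upperHalfPlaneSet, f (-1 / τ) = τ ^ 12 * f τ)
    (h0 : Tendsto f (comap im atTop) (𝓝 0)) :
    ∃ c : ℂ, ∀ τ ∈ upperHalfPlaneSet, f τ = c * ModularForm.eta τ ^ 24 := by
  obtain ⟨F, hF⟩ := exists_cuspForm_levelOne (k := 12) hd hT hS h0
  obtain ⟨c, hc⟩ := ModularFormClass.levelOne_weight_zero_const
    (ModularForm.mcast (by norm_num) (CuspForm.discriminantEquiv F) : ModularForm 𝒮ℒ 0)
  refine ⟨c, fun τ hτ ↦ ?_⟩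
  have h1 := CuspForm.discriminantEquiv_apply F ⟨τ, hτ⟩
  have h2 : (CuspForm.discriminantEquiv F) ⟨τ, hτ⟩ = c := congrFun hc ⟨τ, hτ⟩
  have h3 := ModularForm.discriminant_ne_zero ⟨τ, hτ⟩
  rw [h2, eq_div_iff h3, hF] at h1
  exact h1.symm

lemma eq_zero_of_levelOne_of_lt {f : ℂ → ℂ} {k : ℕ} (hk : k < 12)
    (hd : DifferentiableOn ℂ f upperHalfPlaneSet)
    (hT : ∀ τ ∈ upperHalfPlaneSet, f (τ + 1) = f τ)
    (hS : ∀ τ ∈ upperHalfPlaneSet, f (-1 / τ) = τ ^ k * f τ)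
    (h0 : Tendsto f (comap im atTop) (𝓝 0)) {τ : ℂ} (hτ : τ ∈ upperHalfPlaneSet) : f τ = 0 := by
  obtain ⟨F, hF⟩ := exists_cuspForm_levelOne hd hT hS h0
  have h := ModularFormClass.levelOne_neg_weight_eq_zero (by lia) (CuspForm.discriminantEquiv F)
  have h1 := CuspForm.discriminantEquiv_apply F ⟨τ, hτ⟩
  rw [h, Pi.zero_apply, eq_comm, div_eq_zero_iff, hF] at h1
  exact h1.resolve_right (ModularForm.discriminant_ne_zero _)

/-! ### Behaviour at `i∞` -/

lemma eventually_mem_upperHalfPlaneSet : ∀ᶠ τ in comap im atTop, τ ∈ upperHalfPlaneSet :=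
  tendsto_comap.eventually (eventually_gt_atTop 0)

lemma tendsto_add_one_comap_im :
    Tendsto (fun τ : ℂ ↦ τ + 1) (comap im atTop) (comap im atTop) := by
  refine tendsto_comap_iff.mpr ?_
  simpa [Function.comp_def] using (tendsto_comap : Tendsto im (comap im atTop) atTop)

lemma tendsto_Dq_zero {f : ℂ → ℂ} {c : ℂ} (hd : DifferentiableOn ℂ f upperHalfPlaneSet)
    (hf : Tendsto f (comap im atTop) (𝓝 c)) : Tendsto (Dq f) (comap im atTop) (𝓝 0) := by
  have key : Tendsto (deriv f) (comap im atTop) (𝓝 0) := by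
    rw [Metric.tendsto_nhds] at hf ⊢
    intro ε hε
    obtain ⟨s, hs, hsub⟩ := hf (ε / 2) (half_pos hε)
    obtain ⟨M, hM⟩ := mem_atTop_sets.mp hs
    have ht : ∀ᶠ τ : ℂ in comap im atTop, max M 0 + 2 ≤ τ.im :=
      tendsto_comap.eventually (eventually_ge_atTop _)
    filter_upwards [ht] with τ hτ
    have him {z : ℂ} (hz : z ∈ Metric.closedBall τ 1) : max M 0 + 1 ≤ z.im := by
      have h1 : |(z - τ).im| ≤ 1 := (abs_im_le_norm _).trans (by simpa [dist_eq_norm] using hz)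
      rw [sub_im] at h1
      linarith [(abs_le.mp h1).1]
    have hsubset : Metric.closedBall τ 1 ⊆ upperHalfPlaneSet := fun z hz ↦ by
      have := him hz
      have := le_max_right M 0
      change 0 < z.im
      linarith
    have hcl : DiffContOnCl ℂ (fun z ↦ f z - c) (Metric.ball τ 1) :=
      ((hd.mono hsubset).sub_const c).diffContOnCl_ball subset_rfl
    have := norm_deriv_le_of_forall_mem_sphere_norm_le (C := ε / 2) one_pos hcl fun z hz ↦ by
      have hz' := him (Metric.sphere_subset_closedBall hz)
      have : z ∈ im ⁻¹' s := hM _ (by linarith [le_max_left M 0])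
      have : dist (f z) c < ε / 2 := hsub this
      exact (dist_eq_norm (f z) c ▸ this).le
    rw [deriv_sub_const] at this
    rw [dist_zero_right]
    linarith
  simpa using! key.div_const (2 * ↑Real.pi * I)

lemma differentiableOn_Dq {f : ℂ → ℂ} (hd : DifferentiableOn ℂ f upperHalfPlaneSet) :
    DifferentiableOn ℂ (Dq f) upperHalfPlaneSet :=
  (hd.deriv isOpen_upperHalfPlaneSet).div_const _

/-! ### The theta constants -/

lemma η_eq_eta (τ : ℂ) : η τ = ModularForm.eta τ := by
  rw [η, ModularForm.eta, qpow, Function.Periodic.qParam]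
  congr 2
  · push_cast
    ring
  · simp only [ModularForm.eta_q_eq_pow, qexp]

lemma θ₃_eq_jacobiTheta₂ (τ : ℂ) : θ₃ τ = jacobiTheta₂ 0 τ := by
  refine tsum_congr fun n ↦ ?_
  rw [qpow, jacobiTheta₂_term]
  congr 1
  push_cast
  ring

lemma θ₄_eq_jacobiTheta₂ (τ : ℂ) : θ₄ τ = jacobiTheta₂ (1 / 2) τ := by
  refine tsum_congr fun n ↦ ?_
  rw [qpow, jacobiTheta₂_term, ← exp_pi_mul_I, ← exp_int_mul, ← Complex.exp_add]
  congr 1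
  push_cast
  ring

lemma θ₂_eq_jacobiTheta₂ (τ : ℂ) :
    θ₂ τ = exp (Real.pi * I / 4 * τ) * jacobiTheta₂ (-τ / 2) τ := by
  rw [θ₂, jacobiTheta₂, ← tsum_mul_left]
  refine tsum_congr fun n ↦ ?_
  rw [qpow, jacobiTheta₂_term, ← Complex.exp_add]
  congr 1
  push_cast
  ring

lemma differentiableOn_θ₃ : DifferentiableOn ℂ θ₃ upperHalfPlaneSet := fun τ hτ ↦ by
  rw [funext θ₃_eq_jacobiTheta₂]
  exact (differentiableAt_jacobiTheta₂_snd 0 hτ).differentiableWithinAt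

lemma differentiableOn_θ₄ : DifferentiableOn ℂ θ₄ upperHalfPlaneSet := fun τ hτ ↦ by
  rw [funext θ₄_eq_jacobiTheta₂]
  exact (differentiableAt_jacobiTheta₂_snd _ hτ).differentiableWithinAt

lemma differentiableOn_jacobiTheta₂_neg_half :
    DifferentiableOn ℂ (fun τ ↦ jacobiTheta₂ (-τ / 2) τ) upperHalfPlaneSet := fun τ hτ ↦ by
  have h := (hasFDerivAt_jacobiTheta₂ (-τ / 2) hτ).differentiableAt
  exact (h.comp τ (f := fun τ ↦ (-τ / 2, τ)) (by fun_prop)).differentiableWithinAt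

lemma differentiableOn_θ₂ : DifferentiableOn ℂ θ₂ upperHalfPlaneSet := by
  rw [funext θ₂_eq_jacobiTheta₂]
  exact DifferentiableOn.mul (by fun_prop) differentiableOn_jacobiTheta₂_neg_half

lemma θ₃_add_one (τ : ℂ) : θ₃ (τ + 1) = θ₄ τ := by
  rw [θ₃_eq_jacobiTheta₂, θ₄_eq_jacobiTheta₂]
  refine tsum_congr fun n ↦ exp_eq_exp_iff_exists_int.mpr ?_
  obtain ⟨m, hm⟩ := (Int.even_mul_pred_self n)
  refine ⟨m, ?_⟩
  have hm' : (n : ℂ) * (n - 1) = m + m := mod_cast hm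
  linear_combination (Real.pi * I) * hm'

lemma θ₄_add_one (τ : ℂ) : θ₄ (τ + 1) = θ₃ τ := by
  rw [θ₃_eq_jacobiTheta₂, θ₄_eq_jacobiTheta₂]
  refine tsum_congr fun n ↦ exp_eq_exp_iff_exists_int.mpr ?_
  obtain ⟨m, hm⟩ := (Int.even_mul_succ_self n)
  refine ⟨m, ?_⟩
  have hm' : (n : ℂ) * (n + 1) = m + m := mod_cast hm
  linear_combination (Real.pi * I) * hm'

lemma θ₂_add_one (τ : ℂ) : θ₂ (τ + 1) = exp (Real.pi * I / 4) * θ₂ τ := by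
  rw [θ₂, θ₂, ← tsum_mul_left]
  refine tsum_congr fun n ↦ ?_
  rw [qpow, qpow, ← Complex.exp_add]
  refine exp_eq_exp_iff_exists_int.mpr ?_
  obtain ⟨m, hm⟩ := (Int.even_mul_pred_self n)
  refine ⟨m, ?_⟩
  have hm' : (n : ℂ) * (n - 1) = m + m := mod_cast hm
  push_cast
  linear_combination (Real.pi * I) * hm'

lemma ne_zero_of_mem_upperHalfPlaneSet {τ : ℂ} (hτ : τ ∈ upperHalfPlaneSet) : τ ≠ 0 :=
  (UpperHalfPlane.mk τ hτ).ne_zero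

lemma cpow_half_ne_zero {τ : ℂ} (hτ : τ ∈ upperHalfPlaneSet) : (-I * τ) ^ (1 / 2 : ℂ) ≠ 0 := by
  simp [cpow_eq_zero_iff, ne_zero_of_mem_upperHalfPlaneSet hτ]

lemma neg_one_div_mem {τ : ℂ} (hτ : τ ∈ upperHalfPlaneSet) : -1 / τ ∈ upperHalfPlaneSet := by
  have := (UpperHalfPlane.mk τ hτ).im_inv_neg_coe_pos
  rw [neg_div, one_div, ← inv_neg]
  exact this

lemma θ₃_neg_one_div {τ : ℂ} (hτ : τ ∈ upperHalfPlaneSet) :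
    θ₃ (-1 / τ) = (-I * τ) ^ (1 / 2 : ℂ) * θ₃ τ := by
  have h := jacobiTheta₂_functional_equation 0 τ
  have h0 := cpow_half_ne_zero hτ
  rw [θ₃_eq_jacobiTheta₂, θ₃_eq_jacobiTheta₂, h]
  rw [zero_div, zero_pow two_ne_zero, mul_zero, zero_div, Complex.exp_zero, mul_one, ← mul_assoc,
    mul_one_div, div_self h0, one_mul]

lemma θ₂_neg_one_div {τ : ℂ} (hτ : τ ∈ upperHalfPlaneSet) :
    θ₂ (-1 / τ) = (-I * τ) ^ (1 / 2 : ℂ) * θ₄ τ := by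
  have h := jacobiTheta₂_functional_equation (1 / 2) τ
  have h0 := cpow_half_ne_zero hτ
  rw [θ₄_eq_jacobiTheta₂, θ₂_eq_jacobiTheta₂, h]
  have e1 : 1 / 2 / τ = -(-1 / τ) / 2 := by ring
  have e2 : -↑Real.pi * I * (1 / 2) ^ 2 / τ = ↑Real.pi * I / 4 * (-1 / τ) := by ring
  rw [e1, e2, ← mul_assoc, ← mul_assoc, mul_one_div, div_self h0, one_mul]

lemma θ₄_neg_one_div {τ : ℂ} (hτ : τ ∈ upperHalfPlaneSet) :
    θ₄ (-1 / τ) = (-I * τ) ^ (1 / 2 : ℂ) * θ₂ τ := by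
  have h := jacobiTheta₂_functional_equation (-τ / 2) τ
  have h0 := cpow_half_ne_zero hτ
  have hτ0 := ne_zero_of_mem_upperHalfPlaneSet hτ
  have e1 : -τ / 2 / τ = -(1 / 2) := by field_simp
  have e2 : -↑Real.pi * I * (-τ / 2) ^ 2 / τ = -(↑Real.pi * I / 4 * τ) := by field_simp; ring
  rw [e1, e2, jacobiTheta₂_neg_left, Complex.exp_neg] at h
  rw [θ₄_eq_jacobiTheta₂, θ₂_eq_jacobiTheta₂, h]
  have := Complex.exp_ne_zero (↑Real.pi * I / 4 * τ)
  field_simp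

lemma cpow_half_pow_eight (τ : ℂ) : ((-I * τ) ^ (1 / 2 : ℂ)) ^ 8 = τ ^ 4 := by
  have h := cpow_nat_inv_pow (-I * τ) two_ne_zero
  rw [show (1 / 2 : ℂ) = ((2 : ℕ) : ℂ)⁻¹ by norm_num, show 8 = 2 * 4 from rfl, pow_mul, h, mul_pow,
    neg_pow, I_pow_four]
  norm_num

lemma tendsto_θ₃ : Tendsto θ₃ (comap im atTop) (𝓝 1) := by
  have h : Tendsto (fun τ : ℂ ↦ Real.exp (-Real.pi * τ.im)) (comap im atTop) (𝓝 0) :=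
    Real.tendsto_exp_atBot.comp
      (tendsto_comap.const_mul_atTop_of_neg (neg_lt_zero.mpr Real.pi_pos))
  have h1 := (isBigO_at_im_infty_jacobiTheta_sub_one.trans_tendsto h).add_const 1
  rw [zero_add] at h1
  refine h1.congr fun τ ↦ ?_
  rw [θ₃_eq_jacobiTheta₂, jacobiTheta_eq_jacobiTheta₂, sub_add_cancel]

lemma tendsto_θ₄ : Tendsto θ₄ (comap im atTop) (𝓝 1) :=
  (tendsto_θ₃.comp tendsto_add_one_comap_im).congr θ₃_add_one

lemma tendsto_jacobiTheta₂_neg_half :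
    Tendsto (fun τ ↦ jacobiTheta₂ (-τ / 2) τ) (comap im atTop) (𝓝 2) := by
  have hnorm (n : ℤ) (τ : ℂ) : ‖jacobiTheta₂_term n (-τ / 2) τ‖ =
      Real.exp (-(Real.pi * (n * (n - 1) : ℤ)) * τ.im) := by
    rw [norm_jacobiTheta₂_term]
    congr 1
    have : (-τ / 2).im = -τ.im / 2 := by simp
    rw [this]
    push_cast
    ring
  have hn0 (n : ℤ) : 0 ≤ n * (n - 1) := by
    rcases le_or_gt n 0 with h | h <;> nlinarith
  have key := tendsto_tsum_of_dominated_convergence (𝓕 := comap im atTop)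
    (f := fun (τ : ℂ) n ↦ jacobiTheta₂_term n (-τ / 2) τ)
    (g := fun n : ℤ ↦ if n ∈ ({0, 1} : Finset ℤ) then (1 : ℂ) else 0)
    (bound := fun n ↦ ‖jacobiTheta₂_term n (-I / 2) I‖)
    ((summable_jacobiTheta₂_term_iff _ _).mpr (by simp)).norm ?_ ?_
  · rw [tsum_eq_sum (s := {0, 1}) (by intro b hb; simp [hb])] at key
    norm_num at key
    exact key
  · intro n
    rcases (hn0 n).eq_or_lt' with h | h
    · have hn : n ∈ ({0, 1} : Finset ℤ) := by
        rcases mul_eq_zero.mp h with h | h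
        · simp [h]
        · simp [sub_eq_zero.mp h]
      have h' : (n : ℂ) * (n - 1) = 0 := mod_cast h
      rw [if_pos hn]
      refine tendsto_const_nhds.congr fun τ ↦ ?_
      rw [jacobiTheta₂_term, ← Complex.exp_zero]
      congr 1
      linear_combination -(Real.pi * I * τ) * h'
    · have hn : n ∉ ({0, 1} : Finset ℤ) := by
        intro hn
        simp only [Finset.mem_insert, Finset.mem_singleton] at hn
        rcases hn with rfl | rfl <;> simp at h
      rw [if_neg hn, tendsto_zero_iff_norm_tendsto_zero]
      simp only [hnorm]
      have h' : (0 : ℝ) < (n * (n - 1) : ℤ) := mod_cast h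
      exact Real.tendsto_exp_atBot.comp
        (tendsto_comap.const_mul_atTop_of_neg (neg_lt_zero.mpr (mul_pos Real.pi_pos h')))
  · have ht : ∀ᶠ τ : ℂ in comap im atTop, 1 ≤ τ.im :=
      tendsto_comap.eventually (eventually_ge_atTop _)
    filter_upwards [ht] with τ hτ n
    rw [hnorm, hnorm, Real.exp_le_exp]
    have h' : (0 : ℝ) ≤ (n * (n - 1) : ℤ) := mod_cast hn0 n
    have := mul_nonneg Real.pi_pos.le h'
    simp only [Complex.I_im]
    nlinarith

lemma tendsto_θ₂ : Tendsto θ₂ (comap im atTop) (𝓝 0) := by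
  rw [funext θ₂_eq_jacobiTheta₂, ← zero_mul (2 : ℂ)]
  refine Tendsto.mul ?_ tendsto_jacobiTheta₂_neg_half
  rw [tendsto_exp_nhds_zero_iff]
  have h : Tendsto (fun τ : ℂ ↦ -(Real.pi / 4) * τ.im) (comap im atTop) atBot :=
    tendsto_comap.const_mul_atTop_of_neg (neg_lt_zero.mpr (by positivity))
  refine h.congr fun τ ↦ ?_
  have : (Real.pi * I / 4 * τ : ℂ) = ((Real.pi / 4 : ℝ) : ℂ) * (I * τ) := by push_cast; ring
  rw [this, re_ofReal_mul, I_mul_re]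
  ring

lemma exists_theta_prod_eq_eta : ∃ c : ℂ, c ≠ 0 ∧ ∀ τ ∈ upperHalfPlaneSet,
    (θ₂ τ * θ₃ τ * θ₄ τ) ^ 8 = c * η τ ^ 24 := by
  have he : exp (Real.pi * I / 4) ^ 8 = 1 := by
    rw [← Complex.exp_nat_mul, ← exp_two_pi_mul_I]
    congr 1
    push_cast
    ring
  have hlim := ((tendsto_θ₂.mul tendsto_θ₃).mul tendsto_θ₄).pow 8
  obtain ⟨c, hc⟩ := exists_eq_const_mul_eta_pow (f := fun τ ↦ (θ₂ τ * θ₃ τ * θ₄ τ) ^ 8)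
    (((differentiableOn_θ₂.mul differentiableOn_θ₃).mul differentiableOn_θ₄).pow 8)
    (fun τ _ ↦ by
      simp only [θ₂_add_one, θ₃_add_one, θ₄_add_one, mul_pow, he]
      ring)
    (fun τ hτ ↦ by
      simp only [θ₂_neg_one_div hτ, θ₃_neg_one_div hτ, θ₄_neg_one_div hτ, mul_pow,
        cpow_half_pow_eight]
      ring)
    (by simpa using hlim)
  refine ⟨c, ?_, fun τ hτ ↦ by rw [η_eq_eta]; exact hc τ hτ⟩
  rintro rfl
  have h2 := tendsto_jacobiTheta₂_neg_half.eventually_ne (two_ne_zero)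
  have hne : NeBot (comap im atTop) :=
    (atTop_neBot (α := ℝ)).comap_of_surj fun y ↦ ⟨⟨0, y⟩, rfl⟩
  obtain ⟨τ, h2, h3, h4, hτ⟩ := (h2.and ((tendsto_θ₃.eventually_ne one_ne_zero).and
    ((tendsto_θ₄.eventually_ne one_ne_zero).and eventually_mem_upperHalfPlaneSet))).exists
  have := hc τ hτ
  rw [zero_mul, θ₂_eq_jacobiTheta₂] at this
  simp [h2, h3, h4] at this

lemma theta_ne_zero {τ : ℂ} (hτ : τ ∈ upperHalfPlaneSet) :
    θ₂ τ ≠ 0 ∧ θ₃ τ ≠ 0 ∧ θ₄ τ ≠ 0 := by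
  obtain ⟨c, hc, h⟩ := exists_theta_prod_eq_eta
  have h1 : (θ₂ τ * θ₃ τ * θ₄ τ) ^ 8 ≠ 0 := by
    rw [h τ hτ, η_eq_eta]
    exact mul_ne_zero hc (pow_ne_zero _ (ModularForm.eta_ne_zero hτ))
  have h2 := ne_zero_pow (by norm_num) h1
  exact ⟨left_ne_zero_of_mul (left_ne_zero_of_mul h2),
    right_ne_zero_of_mul (left_ne_zero_of_mul h2), right_ne_zero_of_mul h2⟩

/-! ### Logarithmic derivatives of the theta constants -/

lemma Dq_add_one {f g : ℂ → ℂ} {a : ℂ} (h : ∀ τ, f (τ + 1) = a * g τ) (τ : ℂ) :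
    Dq f (τ + 1) = a * Dq g τ := by
  simp only [Dq]
  rw [← deriv_comp_add_const, funext h, deriv_const_mul_field, mul_div_assoc]

lemma Dq_congr_of_eqOn {f g : ℂ → ℂ} (h : Set.EqOn f g upperHalfPlaneSet) :
    Set.EqOn (Dq f) (Dq g) upperHalfPlaneSet := fun τ hτ ↦ by
  simp only [Dq]
  rw [(h.eventuallyEq_of_mem (isOpen_upperHalfPlaneSet.mem_nhds hτ)).deriv_eq]

lemma DifferentiableOn.hasDerivAt_Dq {f : ℂ → ℂ} (hd : DifferentiableOn ℂ f upperHalfPlaneSet)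
    {τ : ℂ} (hτ : τ ∈ upperHalfPlaneSet) : HasDerivAt f (2 * ↑Real.pi * I * Dq f τ) τ := by
  rw [Dq, mul_div_cancel₀ _ two_pi_I_ne_zero]
  exact (hd.differentiableAt (isOpen_upperHalfPlaneSet.mem_nhds hτ)).hasDerivAt

lemma HasDerivAt.Dq_eq {f : ℂ → ℂ} {f' τ : ℂ} (h : HasDerivAt f (2 * ↑Real.pi * I * f') τ) :
    Dq f τ = f' := by
  rw [Dq, h.deriv, mul_div_cancel_left₀ _ two_pi_I_ne_zero]

lemma Dq_neg_one_div_of_hasDerivAt {f g : ℂ → ℂ} {g' τ : ℂ}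
    (hf : DifferentiableOn ℂ f upperHalfPlaneSet)
    (h : ∀ τ ∈ upperHalfPlaneSet, f (-1 / τ) = g τ) (hτ : τ ∈ upperHalfPlaneSet)
    (hg : HasDerivAt g g' τ) : Dq f (-1 / τ) = τ ^ 2 * (g' / (2 * ↑Real.pi * I)) := by
  have hτ0 := ne_zero_of_mem_upperHalfPlaneSet hτ
  have hinv : HasDerivAt (fun t : ℂ ↦ -1 / t) (1 / τ ^ 2) τ := by
    refine ((hasDerivAt_inv hτ0).neg.congr_of_eventuallyEq (.of_forall fun t ↦ ?_)).congr_deriv ?_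
    · simp [neg_div]
    · simp
  have h1 : HasDerivAt (fun t : ℂ ↦ f (-1 / t)) _ τ :=
    (hf.hasDerivAt_Dq (neg_one_div_mem hτ)).comp τ hinv
  have h2 : (fun t : ℂ ↦ f (-1 / t)) =ᶠ[𝓝 τ] g := by
    filter_upwards [isOpen_upperHalfPlaneSet.mem_nhds hτ] with t ht using h t ht
  have h3 := (h1.congr_of_eventuallyEq h2.symm).unique hg
  have := two_pi_I_ne_zero
  rw [← h3]
  field_simp

lemma hasDerivAt_cpow_half {τ : ℂ} (hτ : τ ∈ upperHalfPlaneSet) :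
    HasDerivAt (fun t : ℂ ↦ (-I * t) ^ (1 / 2 : ℂ)) ((-I * τ) ^ (1 / 2 : ℂ) / (2 * τ)) τ := by
  have hτ0 := ne_zero_of_mem_upperHalfPlaneSet hτ
  have hpos : 0 < τ.im := hτ
  have hs : -I * τ ∈ slitPlane := Or.inl (by simpa using hpos)
  have h0 : -I * τ ≠ 0 := slitPlane_ne_zero hs
  refine (((hasDerivAt_id τ).const_mul (-I)).cpow_const hs).congr_deriv ?_
  simp only [id_eq, mul_one]
  rw [cpow_sub _ _ h0, cpow_one]
  field_simp

lemma logDeriv_neg_one_div {f g : ℂ → ℂ} (hf : DifferentiableOn ℂ f upperHalfPlaneSet)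
    (hg : DifferentiableOn ℂ g upperHalfPlaneSet)
    (h : ∀ τ ∈ upperHalfPlaneSet, f (-1 / τ) = (-I * τ) ^ (1 / 2 : ℂ) * g τ)
    {τ : ℂ} (hτ : τ ∈ upperHalfPlaneSet) (hg0 : g τ ≠ 0) :
    2 * Dq f (-1 / τ) / f (-1 / τ) =
      τ ^ 2 * (2 * Dq g τ / g τ) + (2 * ↑Real.pi * I)⁻¹ * τ := by
  have hτ0 := ne_zero_of_mem_upperHalfPlaneSet hτ
  have hs := cpow_half_ne_zero hτ
  have hpi := two_pi_I_ne_zero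
  rw [Dq_neg_one_div_of_hasDerivAt hf h hτ ((hasDerivAt_cpow_half hτ).mul (hg.hasDerivAt_Dq hτ)),
    h τ hτ]
  generalize (-I * τ) ^ (1 / 2 : ℂ) = s at *
  generalize 2 * ↑Real.pi * I = c at *
  field_simp
  ring

lemma Dq_neg_one_div_of_quasimodular {f g : ℂ → ℂ} (hf : DifferentiableOn ℂ f upperHalfPlaneSet)
    (hg : DifferentiableOn ℂ g upperHalfPlaneSet)
    (h : ∀ τ ∈ upperHalfPlaneSet, f (-1 / τ) = τ ^ 2 * g τ + (2 * ↑Real.pi * I)⁻¹ * τ)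
    {τ : ℂ} (hτ : τ ∈ upperHalfPlaneSet) :
    Dq f (-1 / τ) = τ ^ 4 * Dq g τ + 2 * (2 * ↑Real.pi * I)⁻¹ * τ ^ 3 * g τ
      + (2 * ↑Real.pi * I)⁻¹ ^ 2 * τ ^ 2 := by
  have hpi := two_pi_I_ne_zero
  rw [Dq_neg_one_div_of_hasDerivAt hf h hτ ((((hasDerivAt_id τ).pow 2).mul
    (hg.hasDerivAt_Dq hτ)).add ((hasDerivAt_id τ).const_mul _))]
  generalize 2 * ↑Real.pi * I = c at *
  simp
  field_simp
  ring

lemma differentiableOn_ξ₂ : DifferentiableOn ℂ ξ₂ upperHalfPlaneSet :=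
  ((differentiableOn_Dq differentiableOn_θ₂).const_mul 2).div differentiableOn_θ₂
    fun _ hτ ↦ (theta_ne_zero hτ).1

lemma differentiableOn_ξ₃ : DifferentiableOn ℂ ξ₃ upperHalfPlaneSet :=
  ((differentiableOn_Dq differentiableOn_θ₃).const_mul 2).div differentiableOn_θ₃
    fun _ hτ ↦ (theta_ne_zero hτ).2.1

lemma differentiableOn_ξ₄ : DifferentiableOn ℂ ξ₄ upperHalfPlaneSet :=
  ((differentiableOn_Dq differentiableOn_θ₄).const_mul 2).div differentiableOn_θ₄
    fun _ hτ ↦ (theta_ne_zero hτ).2.2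

lemma ξ₂_add_one (τ : ℂ) : ξ₂ (τ + 1) = ξ₂ τ := by
  have := Complex.exp_ne_zero (Real.pi * I / 4)
  rw [ξ₂, Dq_add_one θ₂_add_one, θ₂_add_one, mul_left_comm, mul_div_mul_left _ _ this]
  rfl

lemma ξ₃_add_one (τ : ℂ) : ξ₃ (τ + 1) = ξ₄ τ := by
  rw [ξ₃, ξ₄, Dq_add_one (a := 1) (by simpa using θ₃_add_one), θ₃_add_one, one_mul]

lemma ξ₄_add_one (τ : ℂ) : ξ₄ (τ + 1) = ξ₃ τ := by
  rw [ξ₃, ξ₄, Dq_add_one (a := 1) (by simpa using θ₄_add_one), θ₄_add_one, one_mul]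

lemma ξ₂_neg_one_div (τ : ℂ) (hτ : τ ∈ upperHalfPlaneSet) :
    ξ₂ (-1 / τ) = τ ^ 2 * ξ₄ τ + (2 * ↑Real.pi * I)⁻¹ * τ :=
  logDeriv_neg_one_div differentiableOn_θ₂ differentiableOn_θ₄ (fun _ ↦ θ₂_neg_one_div) hτ
    (theta_ne_zero hτ).2.2

lemma ξ₃_neg_one_div (τ : ℂ) (hτ : τ ∈ upperHalfPlaneSet) :
    ξ₃ (-1 / τ) = τ ^ 2 * ξ₃ τ + (2 * ↑Real.pi * I)⁻¹ * τ :=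
  logDeriv_neg_one_div differentiableOn_θ₃ differentiableOn_θ₃ (fun _ ↦ θ₃_neg_one_div) hτ
    (theta_ne_zero hτ).2.1

lemma ξ₄_neg_one_div (τ : ℂ) (hτ : τ ∈ upperHalfPlaneSet) :
    ξ₄ (-1 / τ) = τ ^ 2 * ξ₂ τ + (2 * ↑Real.pi * I)⁻¹ * τ :=
  logDeriv_neg_one_div differentiableOn_θ₄ differentiableOn_θ₂ (fun _ ↦ θ₄_neg_one_div) hτ
    (theta_ne_zero hτ).1

lemma tendsto_ξ₃ : Tendsto ξ₃ (comap im atTop) (𝓝 0) := by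
  simpa using! ((tendsto_Dq_zero differentiableOn_θ₃ tendsto_θ₃).const_mul 2).div tendsto_θ₃
    one_ne_zero

lemma tendsto_ξ₄ : Tendsto ξ₄ (comap im atTop) (𝓝 0) := by
  simpa using! ((tendsto_Dq_zero differentiableOn_θ₄ tendsto_θ₄).const_mul 2).div tendsto_θ₄
    one_ne_zero

lemma tendsto_ξ₂ : Tendsto ξ₂ (comap im atTop) (𝓝 (1 / 4)) := by
  have hd := differentiableOn_jacobiTheta₂_neg_half
  have h := (((tendsto_Dq_zero hd tendsto_jacobiTheta₂_neg_half).const_mul 2).div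
    tendsto_jacobiTheta₂_neg_half two_ne_zero).const_add (1 / 4)
  rw [mul_zero, zero_div, add_zero] at h
  refine h.congr' ?_
  filter_upwards [eventually_mem_upperHalfPlaneSet] with τ hτ
  have h1 := ((((hasDerivAt_id τ).const_mul (Real.pi * I / 4)).cexp).mul
    (hd.hasDerivAt_Dq hτ)).congr_of_eventuallyEq (.of_forall θ₂_eq_jacobiTheta₂)
  have h2 := (theta_ne_zero hτ).1
  have hpi := two_pi_I_ne_zero
  have hexp := Complex.exp_ne_zero (Real.pi * I / 4 * τ)
  rw [ξ₂, show Dq θ₂ τ = deriv θ₂ τ / _ from rfl, h1.deriv]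
  rw [θ₂_eq_jacobiTheta₂] at h2 ⊢
  have h3 := right_ne_zero_of_mul h2
  have hpi' : (Real.pi * I / 4 : ℂ) = 2 * ↑Real.pi * I / 8 := by ring
  simp only [id_eq, mul_one, Pi.div_apply]
  rw [hpi'] at hexp ⊢
  generalize 2 * ↑Real.pi * I = c at *
  generalize jacobiTheta₂ (-τ / 2) τ = J at h3 ⊢
  field_simp
  ring

lemma Dq_η_div_η {τ : ℂ} (hτ : τ ∈ upperHalfPlaneSet) :
    Dq η τ / η τ = (ξ₂ τ + ξ₃ τ + ξ₄ τ) / 6 := by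
  obtain ⟨c, hc, h⟩ := exists_theta_prod_eq_eta
  have hη : DifferentiableOn ℂ η upperHalfPlaneSet := fun t ht ↦ by
    rw [funext η_eq_eta]
    exact (ModularForm.differentiableAt_eta_of_mem_upperHalfPlaneSet ht).differentiableWithinAt
  have hη0 : η τ ≠ 0 := η_eq_eta τ ▸ ModularForm.eta_ne_zero hτ
  obtain ⟨h2, h3, h4⟩ := theta_ne_zero hτ
  have hL := (((differentiableOn_θ₂.hasDerivAt_Dq hτ).mul
    (differentiableOn_θ₃.hasDerivAt_Dq hτ)).mul (differentiableOn_θ₄.hasDerivAt_Dq hτ)).pow 8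
  have hR := ((hη.hasDerivAt_Dq hτ).pow 24).const_mul c
  have hLR := hL.unique (hR.congr_of_eventuallyEq (by
    filter_upwards [isOpen_upperHalfPlaneSet.mem_nhds hτ] with t ht using h t ht))
  have hv := h τ hτ
  have hpi := two_pi_I_ne_zero
  simp only [ξ₂, ξ₃, ξ₄, Pi.mul_apply] at hLR ⊢
  generalize 2 * ↑Real.pi * I = d at *
  norm_num at hLR
  have hkey : d * (8 * c * η τ ^ 24 * θ₂ τ * θ₃ τ * θ₄ τ) * (Dq θ₂ τ * θ₃ τ * θ₄ τ * η τ
      + θ₂ τ * Dq θ₃ τ * θ₄ τ * η τ + θ₂ τ * θ₃ τ * Dq θ₄ τ * η τ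
      - 3 * θ₂ τ * θ₃ τ * θ₄ τ * Dq η τ) = 0 := by
    linear_combination (θ₂ τ * θ₃ τ * θ₄ τ) * (η τ * (θ₂ τ * θ₃ τ * θ₄ τ)) * hLR - 8 * d *
      (θ₂ τ * θ₃ τ * θ₄ τ) * η τ * (Dq θ₂ τ * θ₃ τ * θ₄ τ + θ₂ τ * Dq θ₃ τ * θ₄ τ
      + θ₂ τ * θ₃ τ * Dq θ₄ τ) * hv
  have hne : d * (8 * c * η τ ^ 24 * θ₂ τ * θ₃ τ * θ₄ τ) ≠ 0 := by
    simp [hpi, hc, hη0, h2, h3, h4]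
  have := (mul_eq_zero.mp hkey).resolve_left hne
  field_simp
  linear_combination -2 * this

/-! ### The Halphen system for the logarithmic derivatives of the theta constants -/

lemma Dq_ξ₂_add_one (τ : ℂ) : Dq ξ₂ (τ + 1) = Dq ξ₂ τ := by
  rw [Dq_add_one (a := 1) (by simpa using ξ₂_add_one), one_mul]

lemma Dq_ξ₃_add_one (τ : ℂ) : Dq ξ₃ (τ + 1) = Dq ξ₄ τ := by
  rw [Dq_add_one (a := 1) (by simpa using ξ₃_add_one), one_mul]

lemma Dq_ξ₄_add_one (τ : ℂ) : Dq ξ₄ (τ + 1) = Dq ξ₃ τ := by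
  rw [Dq_add_one (a := 1) (by simpa using ξ₄_add_one), one_mul]

/-- The defect of `(g - h)' = 2 f (g - h)`, one of the equations of the Halphen system. -/
noncomputable def halphenDefect (f g h : ℂ → ℂ) : ℂ → ℂ := fun τ ↦
  Dq g τ - Dq h τ - 2 * f τ * (g τ - h τ)

lemma differentiableOn_halphenDefect {f g h : ℂ → ℂ}
    (hf : DifferentiableOn ℂ f upperHalfPlaneSet) (hg : DifferentiableOn ℂ g upperHalfPlaneSet)
    (hh : DifferentiableOn ℂ h upperHalfPlaneSet) :
    DifferentiableOn ℂ (halphenDefect f g h) upperHalfPlaneSet :=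
  ((differentiableOn_Dq hg).sub (differentiableOn_Dq hh)).sub ((hf.const_mul 2).mul (hg.sub hh))

lemma tendsto_halphenDefect {f g h : ℂ → ℂ} {a b c : ℂ}
    (hg : DifferentiableOn ℂ g upperHalfPlaneSet) (hh : DifferentiableOn ℂ h upperHalfPlaneSet)
    (ha : Tendsto f (comap im atTop) (𝓝 a)) (hb : Tendsto g (comap im atTop) (𝓝 b))
    (hc : Tendsto h (comap im atTop) (𝓝 c)) :
    Tendsto (halphenDefect f g h) (comap im atTop) (𝓝 (-2 * a * (b - c))) := by
  have := ((tendsto_Dq_zero hg hb).sub (tendsto_Dq_zero hh hc)).sub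
    ((ha.const_mul 2).mul (hb.sub hc))
  rwa [show (0 : ℂ) - 0 - 2 * a * (b - c) = -2 * a * (b - c) by ring] at this

lemma Dq_ξ₂_neg_one_div {τ : ℂ} (hτ : τ ∈ upperHalfPlaneSet) :
    Dq ξ₂ (-1 / τ) = τ ^ 4 * Dq ξ₄ τ + 2 * (2 * ↑Real.pi * I)⁻¹ * τ ^ 3 * ξ₄ τ
      + (2 * ↑Real.pi * I)⁻¹ ^ 2 * τ ^ 2 :=
  Dq_neg_one_div_of_quasimodular differentiableOn_ξ₂ differentiableOn_ξ₄ ξ₂_neg_one_div hτ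

lemma Dq_ξ₃_neg_one_div {τ : ℂ} (hτ : τ ∈ upperHalfPlaneSet) :
    Dq ξ₃ (-1 / τ) = τ ^ 4 * Dq ξ₃ τ + 2 * (2 * ↑Real.pi * I)⁻¹ * τ ^ 3 * ξ₃ τ
      + (2 * ↑Real.pi * I)⁻¹ ^ 2 * τ ^ 2 :=
  Dq_neg_one_div_of_quasimodular differentiableOn_ξ₃ differentiableOn_ξ₃ ξ₃_neg_one_div hτ

lemma Dq_ξ₄_neg_one_div {τ : ℂ} (hτ : τ ∈ upperHalfPlaneSet) :
    Dq ξ₄ (-1 / τ) = τ ^ 4 * Dq ξ₂ τ + 2 * (2 * ↑Real.pi * I)⁻¹ * τ ^ 3 * ξ₂ τ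
      + (2 * ↑Real.pi * I)⁻¹ ^ 2 * τ ^ 2 :=
  Dq_neg_one_div_of_quasimodular differentiableOn_ξ₄ differentiableOn_ξ₂ ξ₄_neg_one_div hτ

lemma sum_mul_halphenDefect_eq_zero {τ : ℂ} (hτ : τ ∈ upperHalfPlaneSet) :
    (ξ₃ τ - ξ₄ τ) * halphenDefect ξ₂ ξ₃ ξ₄ τ + (ξ₄ τ - ξ₂ τ) * halphenDefect ξ₃ ξ₄ ξ₂ τ
      + (ξ₂ τ - ξ₃ τ) * halphenDefect ξ₄ ξ₂ ξ₃ τ = 0 := by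
  have d2 := differentiableOn_ξ₂
  have d3 := differentiableOn_ξ₃
  have d4 := differentiableOn_ξ₄
  have hlim := (((tendsto_ξ₃.sub tendsto_ξ₄).mul
      (tendsto_halphenDefect d3 d4 tendsto_ξ₂ tendsto_ξ₃ tendsto_ξ₄)).add
    ((tendsto_ξ₄.sub tendsto_ξ₂).mul
      (tendsto_halphenDefect d4 d2 tendsto_ξ₃ tendsto_ξ₄ tendsto_ξ₂))).add
    ((tendsto_ξ₂.sub tendsto_ξ₃).mul
      (tendsto_halphenDefect d2 d3 tendsto_ξ₄ tendsto_ξ₂ tendsto_ξ₃))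
  refine eq_zero_of_levelOne_of_lt (k := 6) (by norm_num)
    (f := fun τ ↦ (ξ₃ τ - ξ₄ τ) * halphenDefect ξ₂ ξ₃ ξ₄ τ
      + (ξ₄ τ - ξ₂ τ) * halphenDefect ξ₃ ξ₄ ξ₂ τ + (ξ₂ τ - ξ₃ τ) * halphenDefect ξ₄ ξ₂ ξ₃ τ)
    ((((d3.sub d4).mul (differentiableOn_halphenDefect d2 d3 d4)).add
      ((d4.sub d2).mul (differentiableOn_halphenDefect d3 d4 d2))).add
      ((d2.sub d3).mul (differentiableOn_halphenDefect d4 d2 d3)))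
    (fun τ _ ↦ ?_) (fun τ hτ ↦ ?_) (by simpa using hlim) hτ
  · simp only [halphenDefect, ξ₂_add_one, ξ₃_add_one, ξ₄_add_one, Dq_ξ₂_add_one, Dq_ξ₃_add_one,
      Dq_ξ₄_add_one]
    ring
  · simp only [halphenDefect, ξ₂_neg_one_div τ hτ, ξ₃_neg_one_div τ hτ, ξ₄_neg_one_div τ hτ,
      Dq_ξ₂_neg_one_div hτ, Dq_ξ₃_neg_one_div hτ, Dq_ξ₄_neg_one_div hτ]
    ring

lemma sum_halphenDefect_sq_eq_zero {τ : ℂ} (hτ : τ ∈ upperHalfPlaneSet) :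
    halphenDefect ξ₂ ξ₃ ξ₄ τ ^ 2 + halphenDefect ξ₃ ξ₄ ξ₂ τ ^ 2
      + halphenDefect ξ₄ ξ₂ ξ₃ τ ^ 2 = 0 := by
  have d2 := differentiableOn_ξ₂
  have d3 := differentiableOn_ξ₃
  have d4 := differentiableOn_ξ₄
  have hlim := (((tendsto_halphenDefect d3 d4 tendsto_ξ₂ tendsto_ξ₃ tendsto_ξ₄).pow 2).add
    ((tendsto_halphenDefect d4 d2 tendsto_ξ₃ tendsto_ξ₄ tendsto_ξ₂).pow 2)).add
    ((tendsto_halphenDefect d2 d3 tendsto_ξ₄ tendsto_ξ₂ tendsto_ξ₃).pow 2)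
  refine eq_zero_of_levelOne_of_lt (k := 8) (by norm_num)
    (f := fun τ ↦ halphenDefect ξ₂ ξ₃ ξ₄ τ ^ 2 + halphenDefect ξ₃ ξ₄ ξ₂ τ ^ 2
      + halphenDefect ξ₄ ξ₂ ξ₃ τ ^ 2)
    ((((differentiableOn_halphenDefect d2 d3 d4).pow 2).add
      ((differentiableOn_halphenDefect d3 d4 d2).pow 2)).add
      ((differentiableOn_halphenDefect d4 d2 d3).pow 2))
    (fun τ _ ↦ ?_) (fun τ hτ ↦ ?_) (by simpa using hlim) hτ
  · simp only [halphenDefect, ξ₂_add_one, ξ₃_add_one, ξ₄_add_one, Dq_ξ₂_add_one, Dq_ξ₃_add_one,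
      Dq_ξ₄_add_one]
    ring
  · simp only [halphenDefect, ξ₂_neg_one_div τ hτ, ξ₃_neg_one_div τ hτ, ξ₄_neg_one_div τ hτ,
      Dq_ξ₂_neg_one_div hτ, Dq_ξ₃_neg_one_div hτ, Dq_ξ₄_neg_one_div hτ]
    ring

/-- A holomorphic function on `ℍ` vanishing for all large `Im τ` vanishes identically. -/
lemma eq_zero_of_eventually_eq_zero {f : ℂ → ℂ} (hf : DifferentiableOn ℂ f upperHalfPlaneSet)
    (h : ∀ᶠ τ in comap im atTop, f τ = 0) {τ : ℂ} (hτ : τ ∈ upperHalfPlaneSet) : f τ = 0 := by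
  rw [eventually_comap, eventually_atTop] at h
  obtain ⟨M, hM⟩ := h
  have hconv : IsPreconnected upperHalfPlaneSet :=
    (convex_halfSpace_im_gt 0).isPreconnected
  have hmem : (⟨0, |M| + 1⟩ : ℂ) ∈ upperHalfPlaneSet := show (0 : ℝ) < |M| + 1 by positivity
  refine (hf.analyticOnNhd isOpen_upperHalfPlaneSet).eqOn_zero_of_preconnected_of_eventuallyEq_zero
    hconv hmem ?_ hτ
  have hlt : M < (⟨0, |M| + 1⟩ : ℂ).im := by
    change M < |M| + 1
    linarith [le_abs_self M]
  filter_upwards [(isOpen_Ioi.preimage Complex.continuous_im).mem_nhds hlt] with t ht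
  exact hM _ (le_of_lt ht) t rfl

/-- If `x + y + z = a x + b y + c z = x ^ 2 + y ^ 2 + z ^ 2 = 0` and the squared differences of
`a, b, c` do not sum to zero, then `x = y = 0`. -/
lemma eq_zero_of_sum_eq_zero {a b c x y z : ℂ} (h1 : x + y + z = 0)
    (h2 : a * x + b * y + c * z = 0) (h3 : x ^ 2 + y ^ 2 + z ^ 2 = 0)
    (hE : (b - c) ^ 2 + (c - a) ^ 2 + (a - b) ^ 2 ≠ 0) : x = 0 ∧ y = 0 := by
  obtain rfl : z = -x - y := by linear_combination h1
  have h4 : (b - c) * y = (c - a) * x := by linear_combination h2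
  have hx : x ^ 2 * ((b - c) ^ 2 + (c - a) ^ 2 + (a - b) ^ 2) = 0 := by
    linear_combination (b - c) ^ 2 * h3
      - (2 * ((b - c) * y + (c - a) * x) + 2 * x * (b - c)) * h4
  have hy : y ^ 2 * ((b - c) ^ 2 + (c - a) ^ 2 + (a - b) ^ 2) = 0 := by
    linear_combination (c - a) ^ 2 * h3
      + (2 * ((b - c) * y + (c - a) * x) + 2 * y * (c - a)) * h4
  simpa [hE] using And.intro hx hy

lemma halphenDefect_eq_zero {τ : ℂ} (hτ : τ ∈ upperHalfPlaneSet) :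
    halphenDefect ξ₂ ξ₃ ξ₄ τ = 0 ∧ halphenDefect ξ₃ ξ₄ ξ₂ τ = 0 := by
  have d2 := differentiableOn_ξ₂
  have d3 := differentiableOn_ξ₃
  have d4 := differentiableOn_ξ₄
  have t34 := tendsto_ξ₃.sub tendsto_ξ₄
  have t42 := tendsto_ξ₄.sub tendsto_ξ₂
  have t23 := tendsto_ξ₂.sub tendsto_ξ₃
  have hE := ((((t42.sub t23).pow 2).add ((t23.sub t34).pow 2)).add
    ((t34.sub t42).pow 2)).eventually_ne (b₂ := 0) (by norm_num)
  have h : ∀ᶠ τ in comap im atTop,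
      halphenDefect ξ₂ ξ₃ ξ₄ τ = 0 ∧ halphenDefect ξ₃ ξ₄ ξ₂ τ = 0 := by
    filter_upwards [hE, eventually_mem_upperHalfPlaneSet] with t hE ht
    exact eq_zero_of_sum_eq_zero (by simp only [halphenDefect]; ring)
      (sum_mul_halphenDefect_eq_zero ht) (sum_halphenDefect_sq_eq_zero ht) hE
  exact ⟨eq_zero_of_eventually_eq_zero (differentiableOn_halphenDefect d2 d3 d4)
      (h.mono fun _ h ↦ h.1) hτ,
    eq_zero_of_eventually_eq_zero (differentiableOn_halphenDefect d3 d4 d2)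
      (h.mono fun _ h ↦ h.2) hτ⟩

lemma sum_Dq_ξ_eq {τ : ℂ} (hτ : τ ∈ upperHalfPlaneSet) :
    (Dq ξ₂ τ + Dq ξ₃ τ + Dq ξ₄ τ) / 6 - 2 * ((ξ₂ τ + ξ₃ τ + ξ₄ τ) / 6) ^ 2
      + (h₀ τ ^ 2 + 3 * h₁ τ ^ 2) / 288 = 0 := by
  have d2 := differentiableOn_ξ₂
  have d3 := differentiableOn_ξ₃
  have d4 := differentiableOn_ξ₄
  have dh₀ : DifferentiableOn ℂ h₀ upperHalfPlaneSet :=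
    ((d2.const_mul 4).sub (d3.const_mul 2)).sub (d4.const_mul 2)
  have dh₁ : DifferentiableOn ℂ h₁ upperHalfPlaneSet := (d3.const_mul 2).sub (d4.const_mul 2)
  have th₀ := ((tendsto_ξ₂.const_mul 4).sub (tendsto_ξ₃.const_mul 2)).sub (tendsto_ξ₄.const_mul 2)
  have th₁ := (tendsto_ξ₃.const_mul 2).sub (tendsto_ξ₄.const_mul 2)
  have hlim := (((((tendsto_Dq_zero d2 tendsto_ξ₂).add (tendsto_Dq_zero d3 tendsto_ξ₃)).add
    (tendsto_Dq_zero d4 tendsto_ξ₄)).div_const 6).sub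
    (((((tendsto_ξ₂.add tendsto_ξ₃).add tendsto_ξ₄).div_const 6).pow 2).const_mul 2)).add
    (((th₀.pow 2).add ((th₁.pow 2).const_mul 3)).div_const 288)
  refine eq_zero_of_levelOne_of_lt (k := 4) (by norm_num)
    (f := fun τ ↦ (Dq ξ₂ τ + Dq ξ₃ τ + Dq ξ₄ τ) / 6 - 2 * ((ξ₂ τ + ξ₃ τ + ξ₄ τ) / 6) ^ 2
      + (h₀ τ ^ 2 + 3 * h₁ τ ^ 2) / 288)
    ((((((differentiableOn_Dq d2).add (differentiableOn_Dq d3)).add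
      (differentiableOn_Dq d4)).div_const 6).sub
      (((((d2.add d3).add d4).div_const 6).pow 2).const_mul 2)).add
      (((dh₀.pow 2).add ((dh₁.pow 2).const_mul 3)).div_const 288))
    (fun τ _ ↦ ?_) (fun τ hτ ↦ ?_) ?_ hτ
  · simp only [h₀, h₁, ξ₂_add_one, ξ₃_add_one, ξ₄_add_one, Dq_ξ₂_add_one, Dq_ξ₃_add_one,
      Dq_ξ₄_add_one]
    ring
  · simp only [h₀, h₁, ξ₂_neg_one_div τ hτ, ξ₃_neg_one_div τ hτ, ξ₄_neg_one_div τ hτ,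
      Dq_ξ₂_neg_one_div hτ, Dq_ξ₃_neg_one_div hτ, Dq_ξ₄_neg_one_div hτ]
    ring
  · rw [show (0 : ℂ) = _ from ?_]
    · exact hlim
    · norm_num


/-- The functions `h₀`, `h₁` and `η'/η` satisfy the stated system of ODEs on `ℍ`. -/
theorem halphen_system_for_h (τ : ℂ) (hτ : 0 < τ.im) :
    Dq h₀ τ = 4 * h₀ τ * (Dq η τ / η τ) - (1/6) * h₀ τ ^ 2 + (1/2) * h₁ τ ^ 2 ∧
    Dq h₁ τ = 4 * h₁ τ * (Dq η τ / η τ) + (1/3) * h₀ τ * h₁ τ ∧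
    Dq (fun t => Dq η t / η t) τ =
      2 * (Dq η τ / η τ) ^ 2 - (1/288) * (h₀ τ ^ 2 + 3 * h₁ τ ^ 2) := by
  have hU : τ ∈ upperHalfPlaneSet := hτ
  obtain ⟨W₂, W₃⟩ := halphenDefect_eq_zero hU
  have V := sum_Dq_ξ_eq hU
  have d2 := differentiableOn_ξ₂.hasDerivAt_Dq hU
  have d3 := differentiableOn_ξ₃.hasDerivAt_Dq hU
  have d4 := differentiableOn_ξ₄.hasDerivAt_Dq hU
  have e₀ : Dq h₀ τ = 4 * Dq ξ₂ τ - 2 * Dq ξ₃ τ - 2 * Dq ξ₄ τ :=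
    ((((d2.const_mul 4).sub (d3.const_mul 2)).sub (d4.const_mul 2)).congr_deriv (by ring)).Dq_eq
  have e₁ : Dq h₁ τ = 2 * Dq ξ₃ τ - 2 * Dq ξ₄ τ :=
    (((d3.const_mul 2).sub (d4.const_mul 2)).congr_deriv (by ring)).Dq_eq
  have e₂ : Dq (fun t => Dq η t / η t) τ = (Dq ξ₂ τ + Dq ξ₃ τ + Dq ξ₄ τ) / 6 := by
    rw [Dq_congr_of_eqOn (fun _ ht ↦ Dq_η_div_η ht) hU]
    exact ((((d2.add d3).add d4).div_const 6).congr_deriv (by ring)).Dq_eq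
  rw [e₀, e₁, e₂, Dq_η_div_η hU]
  simp only [halphenDefect, h₀, h₁] at W₂ W₃ V ⊢
  exact ⟨by linear_combination -2 * W₂ - 4 * W₃, by linear_combination 2 * W₂,
    by linear_combination V⟩
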